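/- Let p be an odd prime, m, k positive integers with e = gcd(k,m) and m/e ≥ 3 odd, p^e ≡ 3 (mod 4), and let d satisfy d(p^k+1) ≡ 2 (mod p^m − 1) and d ≡ 1 + (p^e−1)/2 (mod p^e − 1). Then the number of x ∈ F_{p^m} with Tr(x^d) = 0 equals p^{m−1}, and for each a ∈ F_p^*, the number of x with Tr(x^d) = a equals p^{m−1} + (−1)^{(m−1)/2} p^{(m−1)/2} η(a), where η is the quadratic character of F_p. -/

import Mathlib

open scoped Classical

noncomputable def quadChar (F : Type*) [MonoidWithZero F] (x : F) : ℤ :=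
  if x = 0 then 0 else if IsSquare x then 1 else -1

lemma gs_sum (p : ℕ) [Fact p.Prime] (hp2 : p ≠ 2) (ψ : AddChar (ZMod p) ℂ) (hψ : ψ.IsPrimitive)
    (c : ZMod p) (hc : c ≠ 0) :
    ∑ x : ZMod p, ψ (c * x ^ 2) = (quadraticChar (ZMod p) c : ℂ) *
      gaussSum ((quadraticChar (ZMod p)).ringHomComp (Int.castRingHom ℂ)) ψ := by
  have hF : ringChar (ZMod p) ≠ 2 := by rwa [ZMod.ringChar_zmod_n]
  have h1 : ∑ x : ZMod p, ψ (c * x ^ 2)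
      = ∑ z : ZMod p, ((quadraticChar (ZMod p) z : ℂ) + 1) * ψ (c * z) := by
    rw [← Finset.sum_fiberwise Finset.univ (fun x : ZMod p => x ^ 2)]
    refine Finset.sum_congr rfl fun z _ => ?_
    have h := quadraticChar_card_sqrts hF z
    rw [Finset.sum_congr rfl (g := fun _ => ψ (c * z))
      (by intro x hx; rw [(Finset.mem_filter.mp hx).2])]
    rw [Finset.sum_const, nsmul_eq_mul]
    congr 1
    have h2 : ((Finset.univ.filter fun x : ZMod p => x ^ 2 = z).card : ℤ)
      = quadraticChar (ZMod p) z + 1 := by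
      rw [← h]; congr 2; ext x; simp
    exact_mod_cast h2
  have h2 : ∑ z : ZMod p, ψ (c * z) = 0 := by
    have := AddChar.sum_mulShift c hψ
    simpa [hc, mul_comm] using this
  have h3 := gaussSum_mulShift ((quadraticChar (ZMod p)).ringHomComp (Int.castRingHom ℂ)) ψ
    (Units.mk0 c hc)
  have h4 : (quadraticChar (ZMod p) c : ℂ) * quadraticChar (ZMod p) c = 1 := by
    have := quadraticChar_sq_one hc
    rw [pow_two] at this
    exact_mod_cast this
  rw [h1, ← h3]
  simp only [add_mul, one_mul, Finset.sum_add_distrib, h2, add_zero]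
  simp only [MulChar.ringHomComp_apply, Units.val_mk0, eq_intCast, gaussSum, AddChar.mulShift_apply]
  rw [← mul_assoc, h4, one_mul]

lemma qf_count (p : ℕ) [Fact p.Prime] (hp : p % 4 = 3) (n : ℕ) (hn : Odd n) (w : Fin n → ZMod p)
    (s : ZMod p) (hw : ∏ i, w i = s ^ 2) (hs : s ≠ 0) (a : ZMod p) :
    (((Finset.univ.filter fun x : Fin n → ZMod p => ∑ i, w i * x i ^ 2 = a)).card : ℤ)
      = p ^ (n - 1) + (-1) ^ ((n - 1) / 2) * p ^ ((n - 1) / 2) * quadraticChar (ZMod p) a := by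
  have hp2 : p ≠ 2 := by rintro rfl; simp at hp
  have hF : ringChar (ZMod p) ≠ 2 := by rwa [ZMod.ringChar_zmod_n]
  have hp0 : (p : ℂ) ≠ 0 := by exact_mod_cast (Fact.out : p.Prime).ne_zero
  set ψ : AddChar (ZMod p) ℂ := ZMod.stdAddChar
  have hψ : ψ.IsPrimitive := ZMod.isPrimitive_stdAddChar p
  set χ := (quadraticChar (ZMod p)).ringHomComp (Int.castRingHom ℂ) with hχ
  set G := gaussSum χ ψ with hG
  have hw0 : ∀ i, w i ≠ 0 := by
    intro i hi
    have : ∏ i, w i = 0 := Finset.prod_eq_zero (Finset.mem_univ i) hi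
    rw [hw] at this
    exact hs (by simpa using this)
  have hneg : quadraticChar (ZMod p) (-1) = -1 := by
    rw [quadraticChar_neg_one_iff_not_isSquare, FiniteField.isSquare_neg_one_iff, ZMod.card]
    simp [hp]
  have hχ1 : χ ≠ 1 := by
    intro h
    have := congrArg (fun f => f (-1)) h
    have h1 : (1 : MulChar (ZMod p) ℂ) (-1) = 1 := MulChar.one_apply (by simp)
    simp only [h1, hχ, MulChar.ringHomComp_apply, hneg] at this
    norm_num at this
  have hG2 : G ^ 2 = - p := by
    have := gaussSum_sq hχ1 ((quadraticChar_isQuadratic (ZMod p)).comp _) hψ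
    rw [hG, this, ZMod.card]
    simp [hχ, hneg]
  have hgs : ∀ c : ZMod p, c ≠ 0 → ∑ x : ZMod p, ψ (c * x ^ 2)
      = (quadraticChar (ZMod p) c : ℂ) * G := fun c hc => gs_sum p hp2 ψ hψ c hc
  -- product formula
  have hprod : ∀ t : ZMod p, t ≠ 0 → ∑ x : Fin n → ZMod p, ψ (t * ∑ i, w i * x i ^ 2)
      = (quadraticChar (ZMod p) t : ℂ) * G ^ n := by
    intro t ht
    have h1 : ∏ i : Fin n, ∑ y : ZMod p, ψ (t * w i * y ^ 2)
        = ∑ x : Fin n → ZMod p, ψ (t * ∑ i, w i * x i ^ 2) := by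
      rw [Finset.prod_univ_sum]
      rw [Fintype.piFinset_univ]
      refine Finset.sum_congr rfl fun x _ => ?_
      have hms : ∀ (g : Fin n → ZMod p), ψ (∑ i, g i) = ∏ i, ψ (g i) := by
        intro g
        have := map_prod ψ.toMonoidHom (fun i => Multiplicative.ofAdd (g i)) Finset.univ
        rw [← ofAdd_sum] at this
        exact this
      rw [Finset.mul_sum, hms]
      simp [mul_assoc]
    rw [← h1, Finset.prod_congr rfl (fun i _ => hgs _ (mul_ne_zero ht (hw0 i)))]
    rw [Finset.prod_mul_distrib, Finset.prod_const, Finset.card_univ, Fintype.card_fin]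
    congr 1
    have h2 : ∏ i, quadraticChar (ZMod p) (t * w i) = quadraticChar (ZMod p) t := by
      rw [← map_prod, Finset.prod_mul_distrib, hw, map_mul, quadraticChar_sq_one' hs]
      simp only [Finset.prod_const, Finset.card_univ, Fintype.card_fin, map_pow, mul_one]
      obtain ⟨j, rfl⟩ := hn
      rw [pow_succ, pow_mul, quadraticChar_sq_one ht]; simp
    exact_mod_cast h2
  have horth : (p : ℂ) * ((Finset.univ.filter
      fun x : Fin n → ZMod p => ∑ i, w i * x i ^ 2 = a)).card
      = ∑ t : ZMod p, ∑ x : Fin n → ZMod p, ψ (t * (∑ i, w i * x i ^ 2 - a)) := by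
    rw [Finset.sum_comm]
    rw [Finset.sum_congr rfl (fun x _ => AddChar.sum_mulShift _ hψ)]
    simp only [sub_eq_zero, ZMod.card]
    push_cast
    rw [← Finset.sum_filter, Finset.sum_const, nsmul_eq_mul, mul_comm]
  have hsplit : ∀ t : ZMod p, t ≠ 0 → ∑ x : Fin n → ZMod p, ψ (t * (∑ i, w i * x i ^ 2 - a))
      = (quadraticChar (ZMod p) t : ℂ) * ψ (t * (-a)) * G ^ n := by
    intro t ht
    rw [mul_right_comm, ← hprod t ht, Finset.sum_mul]
    refine Finset.sum_congr rfl fun x _ => ?_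
    rw [← AddChar.map_add_eq_mul]; ring_nf
  have hsum : ∑ t : ZMod p, (quadraticChar (ZMod p) t : ℂ) * ψ (t * (-a))
      = - (quadraticChar (ZMod p) a : ℂ) * G := by
    by_cases ha : a = 0
    · subst ha
      simp
      exact_mod_cast quadraticChar_sum_zero hF
    · have h3 := gaussSum_mulShift χ ψ (Units.mk0 (-a) (neg_ne_zero.mpr ha))
      have h5 : quadraticChar (ZMod p) (-a) = - quadraticChar (ZMod p) a := by
        rw [neg_eq_neg_one_mul, map_mul, hneg]; ring
      have h4 : (quadraticChar (ZMod p) a : ℂ) * quadraticChar (ZMod p) a = 1 := by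
        have := quadraticChar_sq_one ha
        rw [pow_two] at this
        exact_mod_cast this
      rw [hG, ← h3]
      simp only [hχ, MulChar.ringHomComp_apply, Units.val_mk0, eq_intCast, gaussSum,
        AddChar.mulShift_apply, h5]
      push_cast
      rw [← mul_assoc, neg_mul_neg, h4, one_mul]
      exact Finset.sum_congr rfl fun x _ => by rw [mul_comm x]
  have hmain : (p : ℂ) * ((Finset.univ.filter
      fun x : Fin n → ZMod p => ∑ i, w i * x i ^ 2 = a)).card
      = p ^ n - quadraticChar (ZMod p) a * G ^ (n + 1) := by
    rw [horth, ← Finset.add_sum_erase _ _ (Finset.mem_univ (0 : ZMod p))]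
    rw [Finset.sum_congr rfl (fun t ht => hsplit t (Finset.ne_of_mem_erase ht))]
    rw [← Finset.sum_mul]
    have h6 : ∑ t ∈ Finset.univ.erase (0 : ZMod p), (quadraticChar (ZMod p) t : ℂ) * ψ (t * (-a))
        = - (quadraticChar (ZMod p) a : ℂ) * G := by
      rw [← hsum, ← Finset.add_sum_erase _ _ (Finset.mem_univ (0 : ZMod p))]
      simp
    rw [h6]
    simp
    ring
  obtain ⟨j, rfl⟩ := hn
  have e1 : (2 * j + 1 - 1) / 2 = j := by omega
  rw [e1, Nat.add_sub_cancel]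
  have h7 : G ^ (2 * j + 1 + 1) = (-1) ^ (j + 1) * p ^ (j + 1) := by
    rw [← mul_pow, neg_one_mul, ← hG2, ← pow_mul]; ring_nf
  rw [h7] at hmain
  have h8 : (p : ℂ) * ((Finset.univ.filter
      fun x : Fin (2 * j + 1) → ZMod p => ∑ i, w i * x i ^ 2 = a)).card
      = p * (p ^ (2 * j) + (-1) ^ j * p ^ j * quadraticChar (ZMod p) a) := by
    rw [hmain]; ring
  have h9 := mul_left_cancel₀ hp0 h8
  exact_mod_cast h9

lemma discr_sq (p : ℕ) [Fact p.Prime] (F : Type*) [Field F] [Fintype F] [Algebra (ZMod p) F]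
    (hn : Odd (Module.finrank (ZMod p) F))
    (b : Module.Basis (Fin (Module.finrank (ZMod p) F)) (ZMod p) F) :
    ∃ s : ZMod p, s ≠ 0 ∧ Algebra.discr (ZMod p) b = s ^ 2 := by
  have hcard : Fintype.card (Fin (Module.finrank (ZMod p) F)) = Fintype.card Gal(F/(ZMod p)) := by
    rw [Fintype.card_fin, Fintype.card_eq_nat_card, IsGalois.card_aut_eq_finrank]
  let f := Fintype.equivOfCardEq hcard
  let M : Matrix (Fin (Module.finrank (ZMod p) F)) (Fin (Module.finrank (ZMod p) F)) F :=
    Matrix.of fun i j => (f j) (b i)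
  have hM : (Algebra.traceMatrix (ZMod p) b).map (algebraMap (ZMod p) F) = M * M.transpose := by
    ext i j
    rw [Matrix.map_apply, Algebra.traceMatrix_apply, Algebra.traceForm_apply,
      trace_eq_sum_automorphisms, Matrix.mul_apply, ← Equiv.sum_comp f]
    simp [M]
  have hdet : algebraMap (ZMod p) F (Algebra.discr (ZMod p) b) = M.det ^ 2 := by
    rw [Algebra.discr_def, RingHom.map_det, RingHom.mapMatrix_apply, hM, Matrix.det_mul,
      Matrix.det_transpose, pow_two]
  have h0 : Algebra.discr (ZMod p) b ≠ 0 := Algebra.discr_not_zero_of_basis (ZMod p) b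
  set Δ := Algebra.discr (ZMod p) b
  have hnorm := congrArg (Algebra.norm (ZMod p)) hdet
  rw [Algebra.norm_algebraMap, map_pow] at hnorm
  obtain ⟨j, hj⟩ := hn
  have hnorm' : Δ ^ (2 * j + 1) = (Algebra.norm (ZMod p)) M.det ^ 2 := by
    rw [← hnorm]; congr 1; exact hj.symm
  have hpow : Δ ^ j ≠ 0 := pow_ne_zero _ h0
  have key : Δ = (Algebra.norm (ZMod p) M.det / Δ ^ j) ^ 2 := by
    rw [div_pow, ← hnorm']; field_simp; ring
  refine ⟨_, ?_, key⟩
  intro h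
  rw [h] at key
  exact h0 (by simpa using key)

lemma trace_sq_count (p : ℕ) [Fact p.Prime] (hp2 : p ≠ 2)
    (F : Type*) [Field F] [Fintype F] [Algebra (ZMod p) F]
    (hn : Odd (Module.finrank (ZMod p) F)) :
    ∃ (w : Fin (Module.finrank (ZMod p) F) → ZMod p) (s : ZMod p), s ≠ 0 ∧ ∏ i, w i = s ^ 2 ∧
      ∀ a : ZMod p, (Finset.univ.filter
          (fun x : F => Algebra.trace (ZMod p) F (x ^ 2) = a)).card
        = (Finset.univ.filter fun x : Fin (Module.finrank (ZMod p) F) → ZMod p =>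
            ∑ i, w i * x i ^ 2 = a).card := by
  have h2 : (2 : ZMod p) ≠ 0 := by
    have : ringChar (ZMod p) ≠ 2 := by rwa [ZMod.ringChar_zmod_n]
    exact Ring.two_ne_zero this
  let _ : Invertible (2 : ZMod p) := invertibleOfNonzero h2
  obtain ⟨v, hv⟩ := LinearMap.BilinForm.exists_orthogonal_basis (B := Algebra.traceForm (ZMod p) F)
    ⟨fun x y => congr_arg (Algebra.trace (ZMod p) F) (mul_comm x y)⟩
  have hv' : ∀ i j, i ≠ j → Algebra.trace (ZMod p) F (v i * v j) = 0 := fun i j hij => hv hij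
  obtain ⟨s, hs, hd⟩ := discr_sq p F hn v
  refine ⟨fun i => Algebra.trace (ZMod p) F (v i * v i), s, hs, ?_, fun a => ?_⟩
  · rw [← hd, Algebra.discr_def]
    have : Algebra.traceMatrix (ZMod p) v
        = Matrix.diagonal fun i => Algebra.trace (ZMod p) F (v i * v i) := by
      ext i j
      rw [Algebra.traceMatrix_apply, Algebra.traceForm_apply, Matrix.diagonal_apply]
      split_ifs with h
      · rw [h]
      · exact hv' i j h
    rw [this, Matrix.det_diagonal]
  · have key : ∀ x : F, Algebra.trace (ZMod p) F (x ^ 2)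
        = ∑ i, Algebra.trace (ZMod p) F (v i * v i) * (v.equivFun x) i ^ 2 := by
      intro x
      conv_lhs => rw [← v.sum_equivFun x, pow_two, Finset.sum_mul_sum]
      simp only [map_sum]
      refine Finset.sum_congr rfl fun i _ => ?_
      rw [Finset.sum_eq_single i]
      · rw [smul_mul_smul_comm, map_smul, smul_eq_mul]; ring
      · intro j _ hj
        rw [smul_mul_smul_comm, map_smul, hv' i j hj.symm, smul_zero]
      · simp
    refine Finset.card_equiv v.equivFun.toEquiv fun x => ?_
    simp [key x]

lemma pow_reduce (F : Type*) [Field F] [Fintype F] (r d : ℕ) (hq : Fintype.card F - 1 = 2 * r)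
    (hr : Odd r) (hd : 0 < d) (hde : Even d)
    (hcop : ∀ l : ℕ, l.Prime → l ∣ d → l ∣ 2 * r → l ∣ 2) :
    ∃ f : F ≃ F, ∀ x, x ^ d = (f x) ^ 2 := by
  have hcardpos : 0 < r := hr.pos
  have hx1 : ∀ x : F, x ≠ 0 → x ^ (2 * r) = 1 := by
    intro x hx
    rw [← hq]; exact FiniteField.pow_card_sub_one_eq_one x hx
  obtain ⟨c, hc⟩ := hde
  obtain ⟨D, hDodd, hD⟩ : ∃ D, Odd D ∧ (D = c ∨ D = c + r) := by
    rcases Nat.even_or_odd c with h | h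
    · exact ⟨c + r, h.add_odd hr, Or.inr rfl⟩
    · exact ⟨c, h, Or.inl rfl⟩
  have hco : Nat.Coprime (2 * r) D := by
    refine Nat.coprime_of_dvd ?_
    intro l hl h1 h2
    have hl2 : l ≠ 2 := by
      rintro rfl
      exact (Nat.not_even_iff_odd.mpr hDodd) (even_iff_two_dvd.mpr h2)
    have hlr : l ∣ r := by
      rcases (hl.dvd_mul).mp h1 with h | h
      · exact absurd ((Nat.prime_dvd_prime_iff_eq hl Nat.prime_two).mp h) hl2
      · exact h
    have hlc : l ∣ c := by
      rcases hD with h | h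
      · rwa [← h]
      · rw [h] at h2; exact (Nat.dvd_add_left hlr).mp h2
    have := hcop l hl (by rw [hc]; exact dvd_add hlc hlc) h1
    exact hl2 ((Nat.prime_dvd_prime_iff_eq hl Nat.prime_two).mp this)
  have hD0 : D ≠ 0 := hDodd.pos.ne'
  have hinj : Function.Injective fun x : F => x ^ D := by
    intro x y hxy
    simp only at hxy
    by_cases hy : y = 0
    · subst hy
      rw [zero_pow hD0] at hxy
      exact pow_eq_zero_iff hD0 |>.mp hxy
    · have h1 : (x / y) ^ D = 1 := by rw [div_pow, hxy, div_self (pow_ne_zero _ hy)]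
      have hx : x / y ≠ 0 := by
        intro h; rw [h, zero_pow hD0] at h1; exact zero_ne_one h1
      have h2 := Nat.dvd_gcd (orderOf_dvd_of_pow_eq_one (hx1 _ hx)) (orderOf_dvd_of_pow_eq_one h1)
      rw [hco.gcd_eq_one, Nat.dvd_one, orderOf_eq_one_iff] at h2
      exact (div_eq_one_iff_eq hy).mp h2
  refine ⟨Equiv.ofBijective _ (Finite.injective_iff_bijective.mp hinj), fun x => ?_⟩
  simp only [Equiv.ofBijective_apply]
  rw [← pow_mul]
  by_cases hx : x = 0
  · rw [hx, zero_pow hd.ne', zero_pow (by omega)]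
  · rcases hD with h | h
    · rw [h, hc]; ring
    · rw [h, hc, show (c + r) * 2 = (c + c) + 2 * r by ring, pow_add _ (c+c), hx1 x hx, mul_one]

lemma arith1 (p e m : ℕ) (hpe : p ^ e % 4 = 3) (he : e ∣ m) (ho : Odd (m / e)) :
    p % 4 = 3 ∧ Odd m ∧ p ^ m % 4 = 3 := by
  have hsq : ∀ x : ℕ, x % 2 = 1 → ∀ j, x ^ (2 * j) % 4 = 1 := by
    intro x hx j
    have h2 : x ^ 2 % 4 = 1 := by
      have : x % 4 = 1 ∨ x % 4 = 3 := by omega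
      rcases this with h | h <;> simp [Nat.pow_mod, h]
    rw [pow_mul, Nat.pow_mod, h2]; simp
  have hodd : ∀ x n : ℕ, Odd n → x % 4 = 3 → x ^ n % 4 = 3 := by
    rintro x n ⟨j, rfl⟩ hx
    rw [pow_succ, Nat.mul_mod, hsq x (by omega) j, hx]
  have hpo : p % 2 = 1 := by
    by_contra h
    have h0 : p % 2 = 0 := by omega
    have h3 : p ^ e % 2 = 1 := by omega
    rcases Nat.eq_zero_or_pos e with he0 | he0
    · subst he0; simp at hpe
    · rw [Nat.pow_mod, h0, zero_pow he0.ne'] at h3; simp at h3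
  have heo : Odd e := by
    by_contra h
    obtain ⟨j, hj⟩ := Nat.not_odd_iff_even.mp h
    have := hsq p hpo j
    rw [two_mul, ← hj] at this
    omega
  have hp3 : p % 4 = 3 := by
    by_contra h
    have h1 : p % 4 = 1 := by omega
    rw [Nat.pow_mod, h1] at hpe
    simp at hpe
  have hm : Odd m := by
    rw [← Nat.div_mul_cancel he]; exact ho.mul heo
  exact ⟨hp3, hm, hodd p m hm hp3⟩

lemma even_d (P d : ℕ) (hP : P % 4 = 3) (h : d ≡ 1 + (P - 1) / 2 [MOD P - 1]) : Even d := by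
  have h2 : 2 ∣ P - 1 := by omega
  have := h.of_dvd h2
  unfold Nat.ModEq at this
  rw [Nat.even_iff]
  omega

theorem count_trace_of_power_d_half_mod_three_case (p m k : ℕ) (hp : p.Prime)
    (hodd : Odd p) (hk : 0 < k) (e : ℕ) (he : e = Nat.gcd k m)
    (hge : 3 ≤ m / e) (hoddq : Odd (m / e)) (hpe : p ^ e % 4 = 3)
    (d : ℕ) (hd : 0 < d) (hcong : d * (p ^ k + 1) ≡ 2 [MOD p ^ m - 1])
    (hd1 : d ≡ 1 + (p ^ e - 1) / 2 [MOD p ^ e - 1])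
    (F : Type*) [Field F] [Fintype F] [Algebra (ZMod p) F]
    (hcard : Fintype.card F = p ^ m) :
    ((Finset.univ.filter (fun x : F => Algebra.trace (ZMod p) F (x ^ d) = 0)).card
        = p ^ (m - 1)) ∧
    ∀ a : ZMod p, a ≠ 0 →
      (((Finset.univ.filter
          (fun x : F => Algebra.trace (ZMod p) F (x ^ d) = a)).card : ℤ)
        = p ^ (m - 1) + (-1) ^ ((m - 1) / 2) * p ^ ((m - 1) / 2) * quadChar (ZMod p) a) := by
  have : Fact p.Prime := ⟨hp⟩
  have hem : e ∣ m := he ▸ Nat.gcd_dvd_right k m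
  obtain ⟨hp3, hm, hq3⟩ := arith1 p e m hpe hem hoddq
  have hp2 : p ≠ 2 := by rintro rfl; simp at hp3
  have hfr : Module.finrank (ZMod p) F = m := by
    have := Module.card_eq_pow_finrank (K := ZMod p) (V := F)
    rw [hcard, ZMod.card] at this
    exact (Nat.pow_right_injective hp.two_le this).symm
  have hde : Even d := even_d _ d hpe hd1
  have hr : Odd ((p ^ m - 1) / 2) := by rw [Nat.odd_iff]; omega
  have h2r : p ^ m - 1 = 2 * ((p ^ m - 1) / 2) := by omega
  obtain ⟨f, hf⟩ := pow_reduce F ((p ^ m - 1) / 2) d (by rw [hcard]; exact h2r) hr hd hde (by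
    intro l _ h1 h3
    rw [← h2r] at h3
    exact ((hcong.of_dvd h3).dvd_iff (dvd_refl l)).mp (h1.mul_right _))
  obtain ⟨w, s, hs, hw, hcnt⟩ := trace_sq_count p hp2 F (by rw [hfr]; exact hm)
  have hall : ∀ a : ZMod p, (((Finset.univ.filter
          (fun x : F => Algebra.trace (ZMod p) F (x ^ d) = a)).card : ℤ)
        = p ^ (m - 1) + (-1) ^ ((m - 1) / 2) * p ^ ((m - 1) / 2) *
          quadraticChar (ZMod p) a) := by
    intro a
    have h1 : (Finset.univ.filter (fun x : F => Algebra.trace (ZMod p) F (x ^ d) = a)).card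
        = (Finset.univ.filter (fun x : F => Algebra.trace (ZMod p) F (x ^ 2) = a)).card :=
      Finset.card_equiv f fun x => by simp [hf x]
    have h2 := qf_count p hp3 _ (by rw [hfr]; exact hm) w s hw hs a
    rw [h1, hcnt a, h2, hfr]
  refine ⟨?_, fun a ha => ?_⟩
  · have := hall 0
    rw [quadraticChar_zero, mul_zero, add_zero] at this
    exact_mod_cast this
  · rw [hall a]
    congr 2
    simp only [quadChar, quadraticChar_apply, quadraticCharFun]
    by_cases hsq : IsSquare a <;> simp [ha, hsq]
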